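/- For any finite set M, the double sum over all subsets I, J ⊆ M of (-1)^{|I|+|J|} · 2^{|I ∩ J|} equals 1. -/

import Mathlib

theorem stmt_4 {α : Type*} [DecidableEq α] (M : Finset α) :
    ∑ I ∈ M.powerset, ∑ J ∈ M.powerset,
      (-1 : ℚ) ^ (I.card + J.card) * (2 : ℚ) ^ ((I ∩ J).card) = 1 := by
  induction M using Finset.induction_on with
  | empty => simp
  | insert a M ha ih =>
    simp only [Finset.sum_powerset_insert ha, ← Finset.sum_add_distrib]
    refine (Finset.sum_congr rfl fun I hI => Finset.sum_congr rfl fun J hJ => ?_).trans ih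
    have haI : a ∉ I := fun h => ha (Finset.mem_powerset.1 hI h)
    have haJ : a ∉ J := fun h => ha (Finset.mem_powerset.1 hJ h)
    have haIJ : a ∉ I ∩ J := fun h => haI (Finset.mem_inter.1 h).1
    rw [Finset.inter_insert_of_notMem haI, Finset.insert_inter_of_notMem haJ,
      ← Finset.insert_inter_distrib, Finset.card_insert_of_notMem haI,
      Finset.card_insert_of_notMem haJ, Finset.card_insert_of_notMem haIJ]
    ring
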